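/- For any fixed r_i, r_j > 0 and any fixed weights I₁, I₂, I₃ > 1, the set of r_k > 0 such that (r_i, r_j, r_k) is admissible is an open interval in (0, ∞). Consequently, if (r_i, r_j, r̂_k) and (r_i, r_j, r̄_k) both satisfy the non-strict triangle inequalities (generalized inversive distance circle packings) with r̂_k < r̄_k, then for every r_k ∈ (r̂_k, r̄_k) the triple (r_i, r_j, r_k) is admissible. -/

import Mathlib

/-- Inversive distance edge length for radii `a, b` and weight `I` on the edge. -/
noncomputable def lenr (I a b : ℝ) : ℝ :=
  Real.sqrt (a ^ 2 + b ^ 2 + 2 * a * b * I)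

/-- The triple `(r₁, r₂, t)` (with weight `I_k` opposite `v_k`) is admissible, i.e.
its induced lengths satisfy the strict triangle inequalities. -/
def admissible (I₁ I₂ I₃ r₁ r₂ t : ℝ) : Prop :=
  lenr I₃ r₁ r₂ < lenr I₂ r₁ t + lenr I₁ r₂ t ∧
  lenr I₂ r₁ t < lenr I₃ r₁ r₂ + lenr I₁ r₂ t ∧
  lenr I₁ r₂ t < lenr I₃ r₁ r₂ + lenr I₂ r₁ t

/-- The triple `(r₁, r₂, t)` satisfies the non-strict triangle inequalities
(generalized inversive distance circle packing). -/
def generalized (I₁ I₂ I₃ r₁ r₂ t : ℝ) : Prop :=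
  lenr I₃ r₁ r₂ ≤ lenr I₂ r₁ t + lenr I₁ r₂ t ∧
  lenr I₂ r₁ t ≤ lenr I₃ r₁ r₂ + lenr I₁ r₂ t ∧
  lenr I₁ r₂ t ≤ lenr I₃ r₁ r₂ + lenr I₂ r₁ t

theorem lenr_sq {I a b : ℝ} (hI : 1 < I) (ha : 0 < a) (hb : 0 < b) :
    lenr I a b ^ 2 = a ^ 2 + b ^ 2 + 2 * a * b * I :=
  Real.sq_sqrt (by positivity)

theorem lenr_pos {I a b : ℝ} (hI : 1 < I) (ha : 0 < a) (hb : 0 < b) : 0 < lenr I a b :=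
  Real.sqrt_pos.2 (by positivity)

@[fun_prop]
theorem continuous_lenr (I a : ℝ) : Continuous (lenr I a) := by
  unfold lenr
  fun_prop

/-- Heron's polynomial (sixteen times the squared area) in terms of squared side lengths. -/
def heron (A B C : ℝ) : ℝ := 2 * C * (A + B) - (A - B) ^ 2 - C ^ 2

theorem heron_sq (x y z : ℝ) :
    heron (x ^ 2) (y ^ 2) (z ^ 2) = (x + y + z) * ((x + y - z) * ((z + y - x) * (z + x - y))) := by
  unfold heron
  ring

theorem heron_sq_nonneg {x y z : ℝ} (hx : 0 < x) (hy : 0 < y) (hz : 0 < z)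
    (h₁ : z ≤ x + y) (h₂ : x ≤ z + y) (h₃ : y ≤ z + x) : 0 ≤ heron (x ^ 2) (y ^ 2) (z ^ 2) := by
  rw [heron_sq]
  exact mul_nonneg (by positivity)
    (mul_nonneg (by linarith) (mul_nonneg (by linarith) (by linarith)))

theorem triangle_of_heron_sq_pos {x y z : ℝ} (hx : 0 < x) (hy : 0 < y) (hz : 0 < z)
    (h : 0 < heron (x ^ 2) (y ^ 2) (z ^ 2)) : z < x + y ∧ x < z + y ∧ y < z + x := by
  rw [heron_sq] at h
  have h' := pos_of_mul_pos_right h (by positivity : 0 ≤ x + y + z)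
  rcases mul_pos_iff.1 h' with ⟨h₁, h₂⟩ | ⟨h₁, h₂⟩
  · rcases mul_pos_iff.1 h₂ with ⟨h₃, h₄⟩ | ⟨h₃, h₄⟩
    · exact ⟨by linarith, by linarith, by linarith⟩
    · linarith
  · rcases mul_neg_iff.1 h₂ with ⟨h₃, h₄⟩ | ⟨h₃, h₄⟩ <;> linarith

/-- A real quadratic that is negative at `0` and nonnegative at two positive points is positive
strictly between them. -/
theorem quadratic_pos_of_mem_Ioo {p q c x y t : ℝ} (hx : 0 < x) (hc : c < 0)
    (hqx : 0 ≤ p * x ^ 2 + q * x + c) (hqy : 0 ≤ p * y ^ 2 + q * y + c)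
    (hxt : x < t) (hty : t < y) : 0 < p * t ^ 2 + q * t + c := by
  rcases lt_or_ge p 0 with hp | hp
  · have key : (y - x) * (p * t ^ 2 + q * t + c) =
        (y - t) * (p * x ^ 2 + q * x + c) + (t - x) * (p * y ^ 2 + q * y + c)
          + -p * ((y - t) * (t - x) * (y - x)) := by ring
    have h₁ : 0 < y - t := sub_pos.2 hty
    have h₂ : 0 < t - x := sub_pos.2 hxt
    have h₃ : 0 < y - x := by linarith
    have h₄ : 0 < -p := neg_pos.2 hp
    refine pos_of_mul_pos_right ?_ h₃.le
    rw [key]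
    positivity
  · have key : x * (p * t ^ 2 + q * t + c) =
        t * (p * x ^ 2 + q * x + c) + (t - x) * -c + p * (t * x * (t - x)) := by ring
    have h₂ : 0 < t - x := sub_pos.2 hxt
    have ht : 0 < t := hx.trans hxt
    have h₄ : 0 < -c := neg_pos.2 hc
    refine pos_of_mul_pos_right ?_ hx.le
    rw [key]
    positivity

theorem exists_heron_lenr_eq_quadratic {I₁ I₂ I₃ r₁ r₂ : ℝ}
    (hI₁ : 1 < I₁) (hI₂ : 1 < I₂) (hI₃ : 1 < I₃) (hr₁ : 0 < r₁) (hr₂ : 0 < r₂) :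
    ∃ p q c : ℝ, c < 0 ∧ ∀ t, 0 < t →
      heron (lenr I₂ r₁ t ^ 2) (lenr I₁ r₂ t ^ 2) (lenr I₃ r₁ r₂ ^ 2) = p * t ^ 2 + q * t + c := by
  refine ⟨4 * (r₁ ^ 2 + r₂ ^ 2 + 2 * r₁ * r₂ * I₃) - 4 * (r₁ * I₂ - r₂ * I₁) ^ 2,
    4 * (r₁ ^ 2 + r₂ ^ 2 + 2 * r₁ * r₂ * I₃) * (r₁ * I₂ + r₂ * I₁)
      - 4 * (r₁ ^ 2 - r₂ ^ 2) * (r₁ * I₂ - r₂ * I₁),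
    -(4 * (r₁ * r₂) ^ 2 * ((I₃ - 1) * (I₃ + 1))), ?_, fun t ht => ?_⟩
  · have : 0 < I₃ - 1 := sub_pos.2 hI₃
    rw [neg_lt_zero]
    positivity
  · rw [lenr_sq hI₂ hr₁ ht, lenr_sq hI₁ hr₂ ht, lenr_sq hI₃ hr₁ hr₂, heron]
    ring

theorem admissible_of_mem_Ioo {I₁ I₂ I₃ r₁ r₂ x y t : ℝ}
    (hI₁ : 1 < I₁) (hI₂ : 1 < I₂) (hI₃ : 1 < I₃) (hr₁ : 0 < r₁) (hr₂ : 0 < r₂)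
    (hx : 0 < x) (hgx : generalized I₁ I₂ I₃ r₁ r₂ x) (hgy : generalized I₁ I₂ I₃ r₁ r₂ y)
    (ht : t ∈ Set.Ioo x y) : admissible I₁ I₂ I₃ r₁ r₂ t := by
  obtain ⟨p, q, c, hc, hq⟩ := exists_heron_lenr_eq_quadratic hI₁ hI₂ hI₃ hr₁ hr₂
  have nonneg {s : ℝ} (hs : 0 < s) (h : generalized I₁ I₂ I₃ r₁ r₂ s) :
      0 ≤ p * s ^ 2 + q * s + c := by
    rw [← hq s hs]
    exact heron_sq_nonneg (lenr_pos hI₂ hr₁ hs) (lenr_pos hI₁ hr₂ hs) (lenr_pos hI₃ hr₁ hr₂)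
      h.1 h.2.1 h.2.2
  have ht₀ : 0 < t := hx.trans ht.1
  refine triangle_of_heron_sq_pos (lenr_pos hI₂ hr₁ ht₀) (lenr_pos hI₁ hr₂ ht₀)
    (lenr_pos hI₃ hr₁ hr₂) ?_
  rw [hq t ht₀]
  exact quadratic_pos_of_mem_Ioo hx hc (nonneg hx hgx)
    (nonneg (ht₀.trans ht.2) hgy) ht.1 ht.2

theorem admissible.generalized {I₁ I₂ I₃ r₁ r₂ t : ℝ} (h : admissible I₁ I₂ I₃ r₁ r₂ t) :
    generalized I₁ I₂ I₃ r₁ r₂ t :=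
  ⟨h.1.le, h.2.1.le, h.2.2.le⟩

theorem isOpen_setOf_admissible (I₁ I₂ I₃ r₁ r₂ : ℝ) :
    IsOpen {t : ℝ | admissible I₁ I₂ I₃ r₁ r₂ t} := by
  simp only [admissible, Set.ofPred_and]
  refine IsOpen.inter ?_ (IsOpen.inter ?_ ?_) <;>
    exact isOpen_lt (by fun_prop) (by fun_prop)

/-- Proposition 2.6(a): for fixed `r₁, r₂ > 0` and weights `> 1`, the set of
third radii making the triple admissible is an open interval in `(0, ∞)`
(an open, order-connected subset of `ℝ` contained in `(0,∞)`); consequently,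
strictly between two generalized packings every triple is admissible. -/
theorem stmt_6 (I₁ I₂ I₃ r₁ r₂ : ℝ)
    (hI₁ : 1 < I₁) (hI₂ : 1 < I₂) (hI₃ : 1 < I₃)
    (hr₁ : 0 < r₁) (hr₂ : 0 < r₂) :
    (IsOpen {t : ℝ | 0 < t ∧ admissible I₁ I₂ I₃ r₁ r₂ t} ∧
     Set.OrdConnected {t : ℝ | 0 < t ∧ admissible I₁ I₂ I₃ r₁ r₂ t}) ∧
    (∀ rhat rbar : ℝ, 0 < rhat → 0 < rbar →
      generalized I₁ I₂ I₃ r₁ r₂ rhat → generalized I₁ I₂ I₃ r₁ r₂ rbar →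
      rhat < rbar → ∀ t ∈ Set.Ioo rhat rbar, admissible I₁ I₂ I₃ r₁ r₂ t) := by
  refine ⟨⟨isOpen_Ioi.inter (isOpen_setOf_admissible I₁ I₂ I₃ r₁ r₂), ⟨?_⟩⟩, ?_⟩
  · rintro x ⟨hx, hax⟩ y ⟨hy, hay⟩ t ⟨hxt, hty⟩
    refine ⟨hx.trans_le hxt, ?_⟩
    rcases hxt.eq_or_lt with rfl | hxt
    · exact hax
    rcases hty.eq_or_lt with rfl | hty
    · exact hay
    exact admissible_of_mem_Ioo hI₁ hI₂ hI₃ hr₁ hr₂ hx hax.generalized hay.generalized ⟨hxt, hty⟩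
  · intro x y hx _ hgx hgy _ t ht
    exact admissible_of_mem_Ioo hI₁ hI₂ hI₃ hr₁ hr₂ hx hgx hgy ht
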